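/- arXiv:2011.00392 — 4 statements merged into one kernel-verified Lean document; each statement's English description precedes it below -/
import Mathlib

section
/- Uniform convergence for finite hypothesis classes: let H be a finite nonempty set of measurable hypotheses X → Bool, let D be a probability measure on X × Bool, and let ε, δ ∈ (0,1). If m is a natural number with m ≥ log(2|H|/δ) / (2ε²), then the D^m-probability of the event {S ∈ (X × Bool)^m : ∃ h ∈ H, |L_S(h) − L_D(h)| > ε} is at most δ. -/
open MeasureTheory

/-- The true error (risk) of hypothesis `h` under distribution `D` on `X × Bool`. -/
noncomputable def trueError {X : Type*} [MeasurableSpace X]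
    (D : Measure (X × Bool)) (h : X → Bool) : ℝ :=
  (D {p : X × Bool | h p.1 ≠ p.2}).toReal

/-- The empirical error of hypothesis `h` on a sample `S` of size `m`. -/
noncomputable def empError {X : Type*} {m : ℕ}
    (S : Fin m → X × Bool) (h : X → Bool) : ℝ :=
  (∑ i : Fin m, if h (S i).1 ≠ (S i).2 then (1 : ℝ) else 0) / m

/-- **Hoeffding's inequality** on a finite product space, one-sided form. -/
theorem measureReal_pi_le_sum_le_of_hasSubgaussianMGF {Ω : Type*} [MeasurableSpace Ω]
    {D : Measure Ω} [IsProbabilityMeasure D] {g : Ω → ℝ} {c : NNReal}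
    (hg : ProbabilityTheory.HasSubgaussianMGF g c D) (m : ℕ) {t : ℝ} (ht : 0 ≤ t) :
    (Measure.pi fun _ : Fin m => D).real {S | t ≤ ∑ i, g (S i)}
      ≤ Real.exp (-t ^ 2 / (2 * (m * c))) := by
  have hsub : ∀ i ∈ (Finset.univ : Finset (Fin m)), ProbabilityTheory.HasSubgaussianMGF
      (fun S : Fin m → Ω => g (S i)) c (Measure.pi fun _ : Fin m => D) := by
    intro i _
    have hp := measurePreserving_eval (fun _ : Fin m => D) i
    refine ProbabilityTheory.HasSubgaussianMGF.of_map (Y := Function.eval i) hp.aemeasurable ?_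
    rwa [hp.map_eq]
  have key := ProbabilityTheory.HasSubgaussianMGF.measure_sum_ge_le_of_iIndepFun
    (ProbabilityTheory.iIndepFun_pi (μ := fun _ : Fin m => D) (X := fun _ => g)
      fun _ => hg.aemeasurable) hsub ht
  simpa using key

/-- **Hoeffding's inequality** for the empirical mean of a function with values in `[0, 1]`. -/
theorem measureReal_pi_lt_abs_mean_sub_integral_le {Ω : Type*} [MeasurableSpace Ω]
    {D : Measure Ω} [IsProbabilityMeasure D] {f : Ω → ℝ} (hf : AEMeasurable f D)
    (hf01 : ∀ x, f x ∈ Set.Icc (0 : ℝ) 1) {m : ℕ} (hm : 0 < m) {ε : ℝ} (hε : 0 ≤ ε) :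
    (Measure.pi fun _ : Fin m => D).real {S | ε < |(∑ i, f (S i)) / m - ∫ x, f x ∂D|}
      ≤ 2 * Real.exp (-(2 * m * ε ^ 2)) := by
  have hm' : (0 : ℝ) < m := by exact_mod_cast hm
  have hsub := ProbabilityTheory.hasSubgaussianMGF_of_mem_Icc hf (Filter.Eventually.of_forall hf01)
  have ht : 0 ≤ m * ε := by positivity
  have hexp : -(m * ε) ^ 2 / (2 * (m * (((‖(1 : ℝ) - 0‖₊ / 2) ^ 2 : NNReal) : ℝ)))
      = -(2 * m * ε ^ 2) := by
    simp
    field_simp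
  have h1 := measureReal_pi_le_sum_le_of_hasSubgaussianMGF hsub m ht
  have h2 := measureReal_pi_le_sum_le_of_hasSubgaussianMGF hsub.neg m ht
  rw [hexp] at h1 h2
  rw [two_mul]
  refine (measureReal_mono ?_).trans ((measureReal_union_le _ _).trans (add_le_add h1 h2))
  intro S hS
  have hmean : (∑ i, f (S i)) / m - ∫ x, f x ∂D = (∑ i, (f (S i) - ∫ x, f x ∂D)) / m := by
    simp [Finset.sum_sub_distrib]
    field_simp
  rw [Set.mem_ofPred_eq, hmean, lt_abs, ← neg_div, lt_div_iff₀ hm', lt_div_iff₀ hm'] at hS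
  refine hS.imp (fun h => ?_) (fun h => ?_)
  · rw [Set.mem_ofPred_eq]
    linarith
  · simp only [Set.mem_ofPred_eq, Pi.neg_apply, Finset.sum_neg_distrib]
    linarith

/-- The true error and the empirical error of a measurable hypothesis are close with high
probability. -/
theorem measureReal_pi_lt_abs_empError_sub_trueError_le {X : Type*} [MeasurableSpace X]
    {h : X → Bool} (hh : Measurable h) (D : Measure (X × Bool)) [IsProbabilityMeasure D]
    {m : ℕ} (hm : 0 < m) {ε : ℝ} (hε : 0 ≤ ε) :
    (Measure.pi fun _ : Fin m => D).real {S | |empError S h - trueError D h| > ε}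
      ≤ 2 * Real.exp (-(2 * m * ε ^ 2)) := by
  have hs : MeasurableSet {p : X × Bool | h p.1 ≠ p.2} :=
    (measurableSet_eq_fun (hh.comp measurable_fst) measurable_snd).compl
  have hint : ∫ p : X × Bool, (if h p.1 ≠ p.2 then (1 : ℝ) else 0) ∂D = trueError D h := by
    rw [trueError, ← measureReal_def, ← integral_indicator_one hs]
    refine integral_congr_ae (Filter.Eventually.of_forall fun p => ?_)
    simp [Set.indicator_apply]
  have key := measureReal_pi_lt_abs_mean_sub_integral_le (D := D)
    (f := fun p => if h p.1 ≠ p.2 then (1 : ℝ) else 0)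
    (Measurable.ite hs measurable_const measurable_const).aemeasurable
    (fun p => by split_ifs <;> simp) hm hε
  rw [hint] at key
  exact key

/-- Uniform convergence for finite hypothesis classes: if
`m ≥ log(2|H|/δ) / (2ε²)`, then the probability (under the `m`-fold product of
`D`) that some `h ∈ H` has empirical error differing from its true error by
more than `ε` is at most `δ`. -/
theorem uniform_convergence_finite_class
    {X : Type*} [MeasurableSpace X]
    (H : Finset (X → Bool)) (hne : H.Nonempty) (hmeas : ∀ h ∈ H, Measurable h)
    (D : Measure (X × Bool)) [IsProbabilityMeasure D]
    (ε δ : ℝ) (hε : ε ∈ Set.Ioo (0 : ℝ) 1) (hδ : δ ∈ Set.Ioo (0 : ℝ) 1)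
    (m : ℕ) (hm : (m : ℝ) ≥ Real.log (2 * H.card / δ) / (2 * ε ^ 2)) :
    (Measure.pi fun _ : Fin m => D)
      {S : Fin m → X × Bool | ∃ h ∈ H, |empError S h - trueError D h| > ε}
      ≤ ENNReal.ofReal δ := by
  obtain ⟨hε0, -⟩ := hε
  obtain ⟨hδ0, hδ1⟩ := hδ
  have hcard : (1 : ℝ) ≤ H.card := by exact_mod_cast hne.card_pos
  have hlog : 0 < Real.log (2 * H.card / δ) :=
    Real.log_pos (by rw [lt_div_iff₀ hδ0]; linarith)
  have hm0 : 0 < m := by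
    have : (0 : ℝ) < m := lt_of_lt_of_le (by positivity) hm
    exact_mod_cast this
  have hexp : Real.exp (-(2 * m * ε ^ 2)) ≤ δ / (2 * H.card) := by
    rw [ge_iff_le, div_le_iff₀ (by positivity)] at hm
    calc Real.exp (-(2 * m * ε ^ 2)) ≤ Real.exp (-Real.log (2 * H.card / δ)) :=
          Real.exp_le_exp.2 (by linarith)
      _ = δ / (2 * H.card) := by
          rw [Real.exp_neg, Real.exp_log (by positivity), inv_div]
  have hunion : {S : Fin m → X × Bool | ∃ h ∈ H, |empError S h - trueError D h| > ε}
      = ⋃ h ∈ H, {S | |empError S h - trueError D h| > ε} := by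
    ext S
    simp
  rw [ENNReal.le_ofReal_iff_toReal_le (measure_ne_top _ _) hδ0.le, ← measureReal_def, hunion]
  calc (Measure.pi fun _ : Fin m => D).real (⋃ h ∈ H, {S | |empError S h - trueError D h| > ε})
      ≤ ∑ h ∈ H, (Measure.pi fun _ : Fin m => D).real
          {S | |empError S h - trueError D h| > ε} := measureReal_biUnion_finset_le _ _
    _ ≤ ∑ _h ∈ H, 2 * (δ / (2 * H.card)) := Finset.sum_le_sum fun h hh =>
        (measureReal_pi_lt_abs_empError_sub_trueError_le (hmeas h hh) D hm0 hε0.le).trans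
          (by linarith)
    _ = δ := by
        rw [Finset.sum_const, nsmul_eq_mul]
        field_simp
end

section
/- Agnostic PAC learnability of finite classes by empirical risk minimization: let H be a finite nonempty set of measurable hypotheses X → Bool, let D be a probability measure on X × Bool, and let ε, δ ∈ (0,1). If m is a natural number with m ≥ 2 log(2|H|/δ) / ε², then with D^m-probability at least 1 − δ over S ~ D^m, every h_S ∈ H that minimizes the empirical error L_S over H satisfies L_D(h_S) ≤ min_{h ∈ H} L_D(h) + ε. -/
open MeasureTheory

open ProbabilityTheory in
/-- **Hoeffding's inequality**, two-sided, for an i.i.d. sample and a `[0, 1]`-valued function. -/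
theorem measureReal_pi_abs_sum_sub_integral_ge_le {Z : Type*} [MeasurableSpace Z]
    (D : Measure Z) [IsProbabilityMeasure D] {f : Z → ℝ} (hf : Measurable f)
    (hf01 : ∀ z, f z ∈ Set.Icc (0 : ℝ) 1) (m : ℕ) {t : ℝ} (ht : 0 ≤ t) :
    (Measure.pi fun _ : Fin m => D).real {S | t ≤ |∑ i, (f (S i) - ∫ z, f z ∂D)|}
      ≤ 2 * Real.exp (-2 * t ^ 2 / m) := by
  set μ := Measure.pi fun _ : Fin m => D
  have hindep : iIndepFun (fun (i : Fin m) (S : Fin m → Z) => f (S i) - ∫ z, f z ∂D) μ :=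
    iIndepFun_pi (X := fun _ z => f z - ∫ z, f z ∂D)
      (fun _ => (hf.sub_const _).aemeasurable)
  have hsub (i : Fin m) :
      HasSubgaussianMGF (fun S : Fin m → Z => f (S i) - ∫ z, f z ∂D) (1 / 4) μ := by
    have h := hasSubgaussianMGF_of_mem_Icc (μ := μ) (X := fun S : Fin m → Z => f (S i))
      (hf.comp (measurable_pi_apply i)).aemeasurable (ae_of_all _ fun S => hf01 (S i))
    have hint : ∫ S, f (S i) ∂μ = ∫ z, f z ∂D :=
      integral_comp_eval (μ := fun _ : Fin m => D) hf.aestronglyMeasurable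
    rw [hint] at h
    convert h using 1
    norm_num
  have hsum := HasSubgaussianMGF.sum_of_iIndepFun hindep (s := Finset.univ) fun i _ => hsub i
  have hbound : -t ^ 2 / (2 * ((∑ _i : Fin m, (1 / 4 : NNReal) : NNReal) : ℝ))
      = -2 * t ^ 2 / m := by
    rcases eq_or_ne (m : ℝ) 0 with h0 | h0
    · simp [h0]
    · simp
      field_simp
      norm_num
  have hupper := hsum.measure_ge_le ht
  have hlower := hsum.neg.measure_ge_le ht
  rw [hbound] at hupper hlower
  calc μ.real {S | t ≤ |∑ i, (f (S i) - ∫ z, f z ∂D)|}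
      ≤ μ.real ({S | t ≤ ∑ i, (f (S i) - ∫ z, f z ∂D)} ∪
          {S | t ≤ (-fun S : Fin m → Z => ∑ i, (f (S i) - ∫ z, f z ∂D)) S}) :=
        measureReal_mono fun S hS => by
          simpa only [Set.mem_union, Set.mem_ofPred_eq, Pi.neg_apply, le_abs] using hS
    _ ≤ _ := measureReal_union_le _ _
    _ ≤ 2 * Real.exp (-2 * t ^ 2 / m) := by linarith

/-- The empirical error of a fixed measurable hypothesis concentrates around its true error. -/
theorem measureReal_pi_abs_empError_sub_trueError_ge_le {X : Type*} [MeasurableSpace X]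
    (D : Measure (X × Bool)) [IsProbabilityMeasure D] {h : X → Bool} (hh : Measurable h)
    {m : ℕ} (hm : 0 < m) {ε : ℝ} (hε : 0 ≤ ε) :
    (Measure.pi fun _ : Fin m => D).real {S | ε ≤ |empError S h - trueError D h|}
      ≤ 2 * Real.exp (-2 * m * ε ^ 2) := by
  have hm' : (0 : ℝ) < m := Nat.cast_pos.mpr hm
  have hE : MeasurableSet {p : X × Bool | h p.1 ≠ p.2} :=
    (measurableSet_eq_fun (hh.comp measurable_fst) measurable_snd).compl
  set f : X × Bool → ℝ := fun p => if h p.1 ≠ p.2 then 1 else 0 with hfdef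
  have hf : Measurable f := Measurable.ite hE measurable_const measurable_const
  have hf01 (p : X × Bool) : f p ∈ Set.Icc (0 : ℝ) 1 := by
    simp only [hfdef]
    split_ifs <;> simp
  have hint : ∫ p, f p ∂D = trueError D h := by
    have hfind : f = {p : X × Bool | h p.1 ≠ p.2}.indicator 1 := by
      ext p
      simp [hfdef, Set.indicator_apply]
    rw [hfind, integral_indicator_one hE]
    rfl
  have key := measureReal_pi_abs_sum_sub_integral_ge_le D hf hf01 m
    (t := m * ε) (by positivity)
  have hexp : -2 * (m * ε) ^ 2 / (m : ℝ) = -2 * m * ε ^ 2 := by field_simp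
  rw [hint, hexp] at key
  refine le_trans (measureReal_mono fun S hS => ?_) key
  have hsum : ∑ i, (f (S i) - trueError D h) = m * (empError S h - trueError D h) := by
    rw [Finset.sum_sub_distrib, empError, mul_sub, mul_div_cancel₀ _ hm'.ne']
    simp [hfdef]
  rw [Set.mem_ofPred_eq, hsum, abs_mul, abs_of_pos hm']
  exact mul_le_mul_of_nonneg_left hS hm'.le

/-- Agnostic PAC learnability of finite classes by empirical risk minimization:
if `m ≥ 2 log(2|H|/δ) / ε²`, then with probability at least `1 - δ` over
`S ~ D^m`, every empirical risk minimizer `h_S ∈ H` satisfies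
`L_D(h_S) ≤ min_{h ∈ H} L_D(h) + ε`. -/
theorem agnostic_pac_finite_class_erm
    {X : Type*} [MeasurableSpace X]
    (H : Finset (X → Bool)) (hne : H.Nonempty) (hmeas : ∀ h ∈ H, Measurable h)
    (D : Measure (X × Bool)) [IsProbabilityMeasure D]
    (ε δ : ℝ) (hε : ε ∈ Set.Ioo (0 : ℝ) 1) (hδ : δ ∈ Set.Ioo (0 : ℝ) 1)
    (m : ℕ) (hm : (m : ℝ) ≥ 2 * Real.log (2 * H.card / δ) / ε ^ 2) :
    (Measure.pi fun _ : Fin m => D)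
      {S : Fin m → X × Bool |
        ∀ hS ∈ H, (∀ h' ∈ H, empError S hS ≤ empError S h') →
          trueError D hS ≤ H.inf' hne (trueError D) + ε}
      ≥ ENNReal.ofReal (1 - δ) := by
  obtain ⟨hε0, -⟩ := hε
  obtain ⟨hδ0, hδ1⟩ := hδ
  have hcard : (1 : ℝ) ≤ H.card := by exact_mod_cast hne.card_pos
  have hlog : 0 < Real.log (2 * H.card / δ) := by
    apply Real.log_pos
    rw [lt_div_iff₀ hδ0]
    linarith
  have hm0 : 0 < m := by
    have : (0 : ℝ) < m := lt_of_lt_of_le (by positivity) hm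
    exact_mod_cast this
  have hexp : 2 * Real.exp (-2 * m * (ε / 2) ^ 2) ≤ δ / H.card := by
    have hle : -2 * m * (ε / 2) ^ 2 ≤ -Real.log (2 * H.card / δ) := by
      rw [ge_iff_le, div_le_iff₀ (by positivity)] at hm
      linarith
    calc 2 * Real.exp (-2 * m * (ε / 2) ^ 2)
        ≤ 2 * Real.exp (-Real.log (2 * H.card / δ)) := by gcongr
      _ = δ / H.card := by
        rw [Real.exp_neg, Real.exp_log (by positivity)]
        field_simp
  set μ := Measure.pi fun _ : Fin m => D
  set good := {S : Fin m → X × Bool |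
    ∀ hS ∈ H, (∀ h' ∈ H, empError S hS ≤ empError S h') →
      trueError D hS ≤ H.inf' hne (trueError D) + ε}
  set bad := ⋃ h ∈ H, {S : Fin m → X × Bool | ε / 2 ≤ |empError S h - trueError D h|}
  have hbad : μ.real bad ≤ δ := by
    calc μ.real bad
        ≤ ∑ h ∈ H, μ.real {S | ε / 2 ≤ |empError S h - trueError D h|} :=
          measureReal_biUnion_finset_le _ _
      _ ≤ ∑ _h ∈ H, δ / H.card := Finset.sum_le_sum fun h hh =>
          (measureReal_pi_abs_empError_sub_trueError_ge_le D (hmeas h hh) hm0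
            (by positivity)).trans hexp
      _ = δ := by
        rw [Finset.sum_const, nsmul_eq_mul]
        field_simp
  have hcover : Set.univ ⊆ good ∪ bad := by
    intro S _
    by_cases hS : S ∈ bad
    · exact Or.inr hS
    left
    simp only [bad, Set.mem_iUnion, Set.mem_ofPred_eq, not_exists, not_le] at hS
    intro g hg hmin
    obtain ⟨k, hk, hkeq⟩ := H.exists_mem_eq_inf' hne (trueError D)
    rw [hkeq]
    have h1 := abs_lt.mp (hS g hg)
    have h2 := abs_lt.mp (hS k hk)
    linarith [hmin k hk]
  have htotal : 1 ≤ μ.real good + μ.real bad := by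
    calc (1 : ℝ) = μ.real Set.univ := by simp
      _ ≤ μ.real (good ∪ bad) := measureReal_mono hcover
      _ ≤ _ := measureReal_union_le _ _
  exact ENNReal.ofReal_le_of_le_toReal (by change 1 - δ ≤ μ.real good; linarith)
end

section
/- Risk guarantee for the GML (structural risk minimization) rule: let w : ℕ → (0,1] satisfy Σ_{n=1}^∞ w(n) ≤ 1, and let H = ⋃_{n ∈ ℕ} H_n where each H_n is a set of measurable hypotheses X → Bool with |H_n| ≤ 2^{2^n}. For h ∈ H write n(h) for an index with h ∈ H_{n(h)}, and define the objective F_S(h) = L_S(h) + sqrt( (−log(w(n(h))) + log(2^{2^{n(h)} + 1} / δ)) / (2m) ). Fix δ ∈ (0,1), a probability measure D on X × Bool, and m ≥ 1. If ĥ ∈ H minimizes F_S over H for the sample S, then with D^m-probability at least 1 − δ over S ~ D^m, for every h ∈ H one has L_D(ĥ) ≤ L_S(h) + sqrt( (−log(w(n(h))) + log(2^{2^{n(h)} + 1} / δ)) / (2m) ). -/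
open MeasureTheory

/-- The complexity penalty `sqrt((−log w(n) + log(2^(2^n+1)/δ)) / (2m))`
attached to index `n`. -/
noncomputable def penalty (w : ℕ → ℝ) (δ : ℝ) (m : ℕ) (n : ℕ) : ℝ :=
  Real.sqrt ((-Real.log (w n) + Real.log ((2 : ℝ) ^ (2 ^ n + 1) / δ)) / (2 * m))

/-- The lower tail `P(Bin(m, p) ≤ k)` of the binomial distribution. -/
noncomputable def binomTail (m k : ℕ) (p : ℝ) : ℝ :=
  ∑ j ∈ Finset.range (k + 1), (m.choose j : ℝ) * (p ^ j * (1 - p) ^ (m - j))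

theorem binomTail_le {m k : ℕ} {p : ℝ} (hp0 : 0 < p) (hp1 : p ≤ 1) (hkm : k < m)
    (hk : (k : ℝ) < m * p) :
    binomTail m k p ≤
      m.choose k * (p ^ k * (1 - p) ^ (m - k)) * ((m - k) * p / (m * p - k)) := by
  induction k with
  | zero =>
    have hm : (m : ℝ) ≠ 0 := by
      have : 0 < m := hkm
      positivity
    simp [binomTail, hm, hp0.ne']
  | succ k ih =>
    push_cast at hk ⊢
    have ih := ih (by lia) (by linarith)
    have hstep : (m.choose k : ℝ) * (p ^ k * (1 - p) ^ (m - k)) * ((m - k) * p) =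
        m.choose (k + 1) * (p ^ (k + 1) * (1 - p) ^ (m - (k + 1))) * ((k + 1) * (1 - p)) := by
      have hc : (m.choose (k + 1) : ℝ) * (k + 1) = m.choose k * (m - k) := by
        have := Nat.choose_succ_right_eq m k
        rw [← Nat.cast_sub (by lia : k ≤ m)]
        exact_mod_cast this
      have hs : m - k = (m - (k + 1)) + 1 := by lia
      rw [hs, pow_succ, pow_succ]
      linear_combination (-p ^ k * (1 - p) ^ (m - (k + 1)) * (1 - p) * p) * hc
    set b : ℝ := m.choose (k + 1) * (p ^ (k + 1) * (1 - p) ^ (m - (k + 1))) with hb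
    have hb0 : 0 ≤ b := by
      have : 0 ≤ 1 - p := by linarith
      positivity
    have hd : 0 < m * p - (k + 1) := by linarith
    have hd' : 0 < m * p - k := by linarith
    have hN : m * p - (k + 1) ≤ (m - (k + 1)) * p := by nlinarith
    calc binomTail m (k + 1) p = binomTail m k p + b := by
          rw [binomTail, Finset.sum_range_succ]; rfl
      _ ≤ b * ((k + 1) * (1 - p)) / (m * p - k) + b := by
          rw [← hstep, mul_div_assoc]; linarith
      _ = b * (((m - (k + 1)) * p + 1) / (m * p - (k + 1) + 1)) := by
          have : m * p - (k + 1) + 1 = m * p - k := by ring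
          rw [this]
          generalize hD : m * p - k = d at hd'
          have hm : m * p = d + k := by linarith
          have : ((m : ℝ) - (k + 1)) * p + 1 = d + (k + 1) * (1 - p) := by
            linear_combination hm
          rw [this]
          field_simp
          ring
      _ ≤ b * ((m - (k + 1)) * p / (m * p - (k + 1))) := by
          apply mul_le_mul_of_nonneg_left _ hb0
          rw [div_le_div_iff₀ (by linarith) hd]
          nlinarith

theorem binomTail_one {m k : ℕ} (hkm : k < m) : binomTail m k 1 = 0 := by
  refine Finset.sum_eq_zero fun j hj => ?_
  have : m - j ≠ 0 := by have := Finset.mem_range.1 hj; lia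
  simp [this]

/-- The normalised log-likelihood of success probability `x` at success frequency `q`,
compensated by its Gaussian upper bound and a multiple of a quartic correction. -/
noncomputable def logLik (q c x : ℝ) : ℝ :=
  q * Real.log x + (1 - q) * Real.log (1 - x) + 2 * (x - q) ^ 2 +
    c * (2 * (1 - 2 * q) ^ 2 * (x - q) ^ 2 - 16 / 3 * (1 - 2 * q) * (x - q) ^ 3 + 4 * (x - q) ^ 4)

theorem logLik_anti {q c x y : ℝ} (hc1 : c ≤ 1) (hq : 0 ≤ q) (hqx : q ≤ x)
    (hxy : x ≤ y) (hy : y < 1) : logLik q c y ≤ logLik q c x := by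
  have hder : ∀ z, 0 < z → z < 1 → HasDerivAt (logLik q c)
      (q * z⁻¹ + (1 - q) * (-1 / (1 - z)) + 2 * (2 * (z - q)) +
        c * (2 * (1 - 2 * q) ^ 2 * (2 * (z - q)) - 16 / 3 * (1 - 2 * q) * (3 * (z - q) ^ 2) +
          4 * (4 * (z - q) ^ 3))) z := by
    intro z hz0 hz1
    have h1 := (Real.hasDerivAt_log hz0.ne').const_mul q
    have h2 := (((hasDerivAt_id z).const_sub 1).log (by simp; linarith)).const_mul (1 - q)
    have h0 : HasDerivAt (fun z : ℝ => z - q) 1 z := (hasDerivAt_id z).sub_const q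
    have h3 := (h0.pow 2).const_mul 2
    have h4 := (h0.pow 2).const_mul (2 * (1 - 2 * q) ^ 2)
    have h5 := (h0.pow 3).const_mul (16 / 3 * (1 - 2 * q))
    have h6 := (h0.pow 4).const_mul 4
    have h := ((h1.add h2).add h3).add (((h4.sub h5).add h6).const_mul c)
    exact HasDerivAt.congr_deriv (f := logLik q c) h (by norm_num)
  have hcont : ContinuousOn (logLik q c) (Set.Icc x y) := by
    have h1 : ContinuousOn (fun z => q * Real.log z) (Set.Icc x y) := by
      rcases hq.eq_or_lt with rfl | hq
      · simpa using continuousOn_const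
      · exact continuousOn_const.mul (Real.continuousOn_log.mono fun z hz => by
          have := hz.1
          simp; linarith)
    have h2 : ContinuousOn (fun z : ℝ => Real.log (1 - z)) (Set.Icc x y) :=
      ContinuousOn.log (by fun_prop) fun z hz => by linarith [hz.2]
    unfold logLik
    fun_prop
  have : AntitoneOn (logLik q c) (Set.Icc x y) := by
    have hint : ∀ z ∈ interior (Set.Icc x y), 0 < z ∧ z < 1 ∧ q ≤ z := by
      intro z hz
      rw [interior_Icc] at hz
      exact ⟨by linarith [hz.1], by linarith [hz.2], by linarith [hz.1]⟩
    apply antitoneOn_of_deriv_nonpos (convex_Icc x y) hcont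
    · exact fun z hz => (hder z (hint z hz).1
        (hint z hz).2.1).differentiableAt.differentiableWithinAt
    · intro z hz
      obtain ⟨hz0, hz1', hqz⟩ := hint z hz
      have hz1 : 0 < 1 - z := by linarith
      rw [(hder z hz0 (by linarith)).deriv]
      have key : q * z⁻¹ + (1 - q) * (-1 / (1 - z)) + 2 * (2 * (z - q)) +
        c * (2 * (1 - 2 * q) ^ 2 * (2 * (z - q)) - 16 / 3 * (1 - 2 * q) * (3 * (z - q) ^ 2) +
          4 * (4 * (z - q) ^ 3)) =
          -((z - q) * ((1 - 2 * z) ^ 4 + (1 - c) * (1 - 2 * z) ^ 2 * (4 * (z * (1 - z))))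
            / (z * (1 - z))) := by
        field_simp
        ring
      rw [key, neg_nonpos]
      have : 0 ≤ z - q := by linarith
      have : 0 ≤ 1 - c := by linarith
      positivity
  exact this ⟨le_rfl, hxy⟩ ⟨hxy, le_rfl⟩ hxy

theorem exp_mul_logLik {m k : ℕ} (hm : 0 < m) (hkm : k ≤ m) {x : ℝ} (hx0 : 0 < x) (hx1 : x < 1) :
    Real.exp (m * logLik (k / m) 0 x) =
      x ^ k * (1 - x) ^ (m - k) * Real.exp (2 * m * (x - k / m) ^ 2) := by
  have hm' : (m : ℝ) ≠ 0 := by positivity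
  have : m * logLik (k / m) 0 x =
      k * Real.log x + (m - k : ℕ) * Real.log (1 - x) + 2 * m * (x - k / m) ^ 2 := by
    rw [Nat.cast_sub hkm, logLik]
    field_simp
    ring
  rw [this, Real.exp_add, Real.exp_add, mul_comm (k : ℝ), mul_comm ((m - k : ℕ) : ℝ),
    Real.exp_mul, Real.exp_mul, Real.exp_log hx0, Real.exp_log (by linarith),
    Real.rpow_natCast, Real.rpow_natCast]

/-- The refined Hoeffding bound: the prefactor may be evaluated at any smaller gap `e`. -/
theorem binomTail_le_exp_mul {m k : ℕ} (hkm : k < m) {p e ε : ℝ} (he : 0 < e) (heε : e ≤ ε)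
    (hp : k / m + ε < p) (hp1 : p ≤ 1) :
    binomTail m k p ≤ Real.exp (-(2 * m * ε ^ 2)) *
      (m.choose k * Real.exp (m * logLik (k / m) 0 (k / m + e)) *
        ((1 - k / m) * (k / m + e) / e)) := by
  have hm : 0 < m := by lia
  have hm' : (0 : ℝ) < m := by positivity
  set q : ℝ := k / m with hq
  have hq0 : 0 ≤ q := by positivity
  have hqm : (k : ℝ) = m * q := by rw [hq]; field_simp
  have hq1 : 0 ≤ 1 - q := by linarith
  rcases hp1.eq_or_lt with rfl | hp1'
  · rw [binomTail_one hkm]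
    positivity
  have hp0 : 0 < p := by linarith
  have hpq : 0 < p - q := by linarith
  refine (binomTail_le hp0 hp1 hkm (by rw [hqm]; nlinarith)).trans ?_
  have h1 : ((m : ℝ) - k) * p / (m * p - k) = (1 - q) * p / (p - q) := by
    rw [hqm, div_eq_div_iff (by nlinarith) hpq.ne']
    ring
  have h2 : (1 - q) * p / (p - q) ≤ (1 - q) * (q + e) / e := by
    rw [div_le_div_iff₀ hpq he, mul_assoc, mul_assoc]
    apply mul_le_mul_of_nonneg_left _ hq1
    nlinarith
  have h3 : p ^ k * (1 - p) ^ (m - k) ≤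
      Real.exp (-(2 * m * ε ^ 2)) * Real.exp (m * logLik q 0 (q + e)) := by
    have := exp_mul_logLik hm hkm.le hp0 hp1'
    rw [← hq] at this
    have hA : p ^ k * (1 - p) ^ (m - k) =
        Real.exp (-(2 * m * (p - q) ^ 2)) * Real.exp (m * logLik q 0 p) := by
      rw [this, Real.exp_neg]
      field_simp
    rw [hA]
    refine mul_le_mul (Real.exp_le_exp.2 ?_) (Real.exp_le_exp.2 ?_) (Real.exp_nonneg _)
      (Real.exp_nonneg _)
    · have : ε ^ 2 ≤ (p - q) ^ 2 := pow_le_pow_left₀ (by linarith) (by linarith) 2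
      rw [neg_le_neg_iff]
      exact mul_le_mul_of_nonneg_left this (by positivity)
    · exact mul_le_mul_of_nonneg_left (logLik_anti zero_le_one hq0 (by linarith)
        (by linarith) hp1') hm'.le
  rw [h1]
  calc _ ≤ m.choose k * (Real.exp (-(2 * m * ε ^ 2)) * Real.exp (m * logLik q 0 (q + e))) *
        ((1 - q) * (q + e) / e) := by gcongr
    _ = _ := by ring

/-- Bitwise approximation from below to the square root of `N`. -/
def floorSqrt (N : ℕ) : ℕ → ℕ
  | 0 => 0
  | i + 1 =>
    let r := floorSqrt N i
    if (r + 2 ^ (12 - i)) ^ 2 ≤ N then r + 2 ^ (12 - i) else r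

theorem floorSqrt_sq_le (N i : ℕ) : floorSqrt N i ^ 2 ≤ N := by
  induction i with
  | zero => simp [floorSqrt]
  | succ i ih =>
    simp only [floorSqrt]
    split_ifs with h
    · exact h
    · exact ih

/-- An integer certificate for the bound `num / den` on the prefactor of the refined Hoeffding
bound, at the gap `floorSqrt _ 13 / (128 * m)`. -/
def tailCheck (n m k num den : ℕ) : Bool :=
  let x := floorSqrt ((2 ^ n + 1) * m * 128 ^ 2 * 6931 / 20000) 13
  Nat.blt 0 x && (Nat.ble (m * 128) (k * 128 + x) ||
  Nat.ble (m.factorial * (k * 128 + x) ^ (k + 1) * (m * 128 - (k * 128 + x)) ^ (m - k) * (m - k) *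
      2 ^ (2 ^ n + 1) * den)
    (num * (m * 128) ^ m * m * x * (k.factorial * (m - k).factorial)))

theorem binomTail_le_of_tailCheck {n m k num den : ℕ} (hkm : k < m) (hden : 0 < den)
    (hc : tailCheck n m k num den = true) {ε p : ℝ} (hε0 : 0 ≤ ε)
    (hε : (2 ^ n + 1) * Real.log 2 ≤ 2 * m * ε ^ 2) (hp : k / m + ε < p) (hp1 : p ≤ 1) :
    binomTail m k p ≤ Real.exp (-(2 * m * ε ^ 2)) * (num / den) := by
  have hm : 0 < m := by lia
  have hm' : (0 : ℝ) < m := by positivity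
  simp only [tailCheck] at hc
  have hx2 := floorSqrt_sq_le ((2 ^ n + 1) * m * 128 ^ 2 * 6931 / 20000) 13
  generalize floorSqrt ((2 ^ n + 1) * m * 128 ^ 2 * 6931 / 20000) 13 = x at hc hx2
  simp only [Bool.and_eq_true, Bool.or_eq_true, Nat.blt_eq, Nat.ble_eq] at hc
  obtain ⟨hx0, hc⟩ := hc
  have hx0' : (0 : ℝ) < x := by exact_mod_cast hx0
  have hx2' : (x : ℝ) ^ 2 * 20000 ≤ (2 ^ n + 1) * m * 128 ^ 2 * 6931 := by
    have := (Nat.le_div_iff_mul_le (by norm_num)).1 hx2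
    exact_mod_cast this
  set e : ℝ := x / (128 * m) with he
  have he0 : 0 < e := by positivity
  have hxe : (x : ℝ) = e * (128 * m) := by rw [he]; field_simp
  have hlog := Real.log_two_gt_d9
  have h2n : (0 : ℝ) < 2 ^ n + 1 := by positivity
  have he2 : 2 * m * e ^ 2 ≤ (2 ^ n + 1) * Real.log 2 := by
    rw [hxe] at hx2'
    have : 2 * m * e ^ 2 ≤ (2 ^ n + 1) * 0.6931 := by
      refine le_of_mul_le_mul_right ?_ (by positivity : 0 < 10000 * 128 ^ 2 * (m : ℝ))
      linarith
    refine this.trans ?_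
    gcongr
    linarith
  have heε : e ≤ ε := by
    refine (pow_le_pow_iff_left₀ he0.le hε0 two_ne_zero).1 ?_
    exact le_of_mul_le_mul_left (he2.trans hε) (by positivity)
  have hqe : (k : ℝ) / m + e = (k * 128 + x) / (m * 128) := by
    rw [hxe]; field_simp
  rcases hc with hc | hc
  · have hc' : (m : ℝ) * 128 ≤ k * 128 + x := by exact_mod_cast hc
    have : 1 ≤ (k : ℝ) / m + e := by
      rw [hqe, one_le_div (by positivity)]
      exact hc'
    linarith
  have hlt : (k * 128 + x : ℝ) < m * 128 := by
    rw [← div_lt_one (by positivity), ← hqe]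
    linarith
  refine (binomTail_le_exp_mul hkm he0 heε hp hp1).trans ?_
  refine mul_le_mul_of_nonneg_left ?_ (Real.exp_nonneg _)
  rw [exp_mul_logLik hm hkm.le (by positivity) (by linarith)]
  have hexp : Real.exp (2 * m * (k / m + e - k / m) ^ 2) ≤ 2 ^ (2 ^ n + 1) := by
    rw [add_sub_cancel_left]
    refine (Real.exp_le_exp.2 he2).trans_eq ?_
    rw [mul_comm, Real.exp_mul, Real.exp_log (by norm_num)]
    exact_mod_cast Real.rpow_natCast 2 (2 ^ n + 1)
  rw [Nat.cast_choose ℝ hkm.le]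
  have hsub : ((m * 128 - (k * 128 + x) : ℕ) : ℝ) = m * 128 - (k * 128 + x) := by
    rw [Nat.cast_sub (by exact_mod_cast hlt.le)]
    push_cast
    ring
  have hsub' : ((m - k : ℕ) : ℝ) = m - k := Nat.cast_sub hkm.le
  have h1q : 1 - ((k : ℝ) / m + e) = (m * 128 - (k * 128 + x)) / (m * 128) := by
    rw [hqe]; field_simp
  have hmk : (0 : ℝ) < m - k := by
    rw [← hsub']
    have : 0 < m - k := by lia
    positivity
  have hpos : (0 : ℝ) < m * 128 - (k * 128 + x) := by linarith
  have hc' : (m.factorial : ℝ) * (k * 128 + x) ^ (k + 1) * (m * 128 - (k * 128 + x)) ^ (m - k) *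
      (m - k) * 2 ^ (2 ^ n + 1) * den ≤
      num * (m * 128) ^ m * m * x * (k.factorial * (m - k).factorial) := by
    rw [← hsub, ← hsub']
    exact_mod_cast hc
  have hpw : ((m : ℝ) * 128) ^ m = (m * 128) ^ k * (m * 128) ^ (m - k) := by
    rw [← pow_add]; congr 1; lia
  rw [h1q]
  have h1k : 1 - (k : ℝ) / m = (m - k) / m := by field_simp
  calc _ ≤ (m.factorial : ℝ) / (k.factorial * (m - k).factorial) *
        ((k / m + e) ^ k * ((m * 128 - (k * 128 + x)) / (m * 128)) ^ (m - k) *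
          2 ^ (2 ^ n + 1)) * ((1 - k / m) * (k / m + e) / e) := by
        have : 0 ≤ 1 - (k : ℝ) / m := by rw [h1k]; positivity
        gcongr
    _ = (m.factorial * (k * 128 + x) ^ (k + 1) * (m * 128 - (k * 128 + x)) ^ (m - k) *
      (m - k) * 2 ^ (2 ^ n + 1) : ℝ) /
      ((m * 128) ^ m * m * x * (k.factorial * (m - k).factorial)) := by
        rw [hqe, h1k, hpw, he]
        generalize (m * 128 - (k * 128 + x) : ℝ) = c
        generalize (k * 128 + x : ℝ) = d
        rw [div_pow, div_pow, pow_succ]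
        field_simp
        ring
    _ ≤ _ := by
        rw [div_le_div_iff₀ (by positivity) (by positivity)]
        linarith

/-- `tailCheck` for all sample sizes in `[lo, hi)` and all error counts. -/
def tailCheckRange (n lo hi num den : ℕ) : Bool :=
  (List.range' lo (hi - lo)).all fun m => (List.range m).all fun k => tailCheck n m k num den

theorem tailCheck_of_tailCheckRange {n lo hi num den : ℕ}
    (h : tailCheckRange n lo hi num den = true) {m k : ℕ} (hlo : lo ≤ m) (hhi : m < hi)
    (hk : k < m) : tailCheck n m k num den = true := by
  rw [tailCheckRange, List.all_eq_true] at h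
  have h := h m (List.mem_range'_1.2 ⟨hlo, by lia⟩)
  rw [List.all_eq_true] at h
  exact h k (List.mem_range.2 hk)

/-- At sample size `m`, the binomial tails at the confidence levels required at index `n` are
smaller than Hoeffding's bound by a factor `r n`, with these factors summing to at most `2`. -/
def HasTailFactors (m : ℕ) (r : ℕ → ℝ) : Prop :=
  (∀ n, 0 ≤ r n) ∧ Summable r ∧ ∑' n, r n ≤ 2 ∧
    ∀ n k : ℕ, ∀ ε p : ℝ, k < m → 0 ≤ ε → (2 ^ n + 1) * Real.log 2 ≤ 2 * m * ε ^ 2 →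
      k / m + ε < p → p ≤ 1 → binomTail m k p ≤ Real.exp (-(2 * m * ε ^ 2)) * r n

theorem hasTailFactors_of_checks {lo hi N A B C : ℕ} (h0 : tailCheckRange 0 lo hi A 1000 = true)
    (h1 : tailCheckRange 1 lo hi B 1000 = true)
    (h4 : N ≤ 4 ∨ tailCheckRange 4 lo hi C 1000 = true)
    (hN : 20000 * hi ≤ (2 ^ N + 1) * 6931 + 20000)
    (hsum : ∑ n ∈ Finset.range N, (if n = 0 then A else if n < 4 then B else C) ≤ 2000)
    {m : ℕ} (hlo : lo ≤ m) (hhi : m < hi) : ∃ r, HasTailFactors m r := by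
  set s : ℕ → ℕ := fun n => if n = 0 then A else if n < 4 then B else C with hs
  set r : ℕ → ℝ := fun n => if n < N then (s n : ℝ) / (1000 : ℕ) else 0 with hr
  have hsupp : ∀ n ∉ Finset.range N, r n = 0 := by
    intro n hn
    simp only [hr]
    rw [if_neg (by simpa using hn)]
  refine ⟨r, fun n => ?_, summable_of_ne_finset_zero hsupp, ?_, ?_⟩
  · simp only [hr]
    split_ifs <;> positivity
  · rw [tsum_eq_sum hsupp]
    have : ∑ n ∈ Finset.range N, r n = (∑ n ∈ Finset.range N, s n : ℕ) / (1000 : ℝ) := by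
      rw [Nat.cast_sum, Finset.sum_div]
      refine Finset.sum_congr rfl fun n hn => ?_
      simp only [hr]
      rw [if_pos (Finset.mem_range.1 hn)]
      norm_num
    rw [this, div_le_iff₀ (by norm_num)]
    exact_mod_cast hsum
  · intro n k ε p hk hε0 hε hp hp1
    have hlog := Real.log_two_gt_d9
    have mono : ∀ i ≤ n, ((2 : ℝ) ^ i + 1) * Real.log 2 ≤ 2 * m * ε ^ 2 := by
      intro i hi
      refine le_trans ?_ hε
      gcongr
      norm_num
    by_cases hn : n < N
    · simp only [hr, if_pos hn, hs]
      split_ifs with hn0 hn4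
      · exact binomTail_le_of_tailCheck hk (by norm_num)
          (tailCheck_of_tailCheckRange h0 hlo hhi hk) hε0 (mono 0 (by lia)) hp hp1
      · exact binomTail_le_of_tailCheck hk (by norm_num)
          (tailCheck_of_tailCheckRange h1 hlo hhi hk) hε0 (mono 1 (by lia)) hp hp1
      · exact binomTail_le_of_tailCheck hk (by norm_num)
          (tailCheck_of_tailCheckRange (h4.resolve_left (by lia)) hlo hhi hk) hε0
          (mono 4 (by lia)) hp hp1
    · exfalso
      have hm : (0 : ℝ) < m := by
        have : 0 < m := by lia
        positivity
      have hk0 : (0 : ℝ) ≤ k / m := by positivity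
      have h1 := mono N (by lia)
      have h2 : (20000 : ℝ) * m ≤ (2 ^ N + 1) * 6931 := by
        have : 20000 * m ≤ (2 ^ N + 1) * 6931 := by lia
        exact_mod_cast this
      have h3 : (0 : ℝ) < 2 ^ N + 1 := by positivity
      have h4 : 1 < ε ^ 2 := by
        have : (2 ^ N + 1) * 0.6931 < (2 ^ N + 1) * Real.log 2 :=
          mul_lt_mul_of_pos_left (by linarith) h3
        nlinarith
      nlinarith

theorem exists_hasTailFactors_of_lt {m : ℕ} (hm : 1 ≤ m) (hm' : m < 128) :
    ∃ r, HasTailFactors m r := by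
  rcases lt_or_ge m 4 with h4 | h4
  · exact hasTailFactors_of_checks (N := 3) (A := 720) (B := 640) (C := 0)
      (by decide +kernel) (by decide +kernel) (by decide +kernel) (by decide) (by decide) hm h4
  rcases lt_or_ge m 6 with h6 | h6
  · exact hasTailFactors_of_checks (N := 4) (A := 500) (B := 500) (C := 0)
      (by decide +kernel) (by decide +kernel) (by decide +kernel) (by decide) (by decide) h4 h6
  rcases lt_or_ge m 12 with h12 | h12
  · exact hasTailFactors_of_checks (N := 5) (A := 450) (B := 450) (C := 100)
      (by decide +kernel) (by decide +kernel) (by decide +kernel) (by decide) (by decide) h6 h12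
  rcases lt_or_ge m 23 with h23 | h23
  · exact hasTailFactors_of_checks (N := 6) (A := 380) (B := 380) (C := 120)
      (by decide +kernel) (by decide +kernel) (by decide +kernel) (by decide) (by decide) h12 h23
  · exact hasTailFactors_of_checks (N := 9) (A := 340) (B := 340) (C := 125)
      (by decide +kernel) (by decide +kernel) (by decide +kernel) (by decide) (by decide) h23 hm'

/-- Stirling's upper bound for the largest term of the binomial distribution. -/
theorem choose_mul_sq_le {m k : ℕ} (hk : 0 < k) (hkm : k < m) :
    ((m.choose k : ℝ) * ((k / m) ^ k * (1 - k / m) ^ (m - k))) ^ 2 *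
      (2 * Real.pi * m * (k / m) * (1 - k / m)) ≤ 1 := by
  obtain ⟨l, hl, rfl⟩ : ∃ l, 0 < l ∧ m = k + l := ⟨m - k, by lia, by lia⟩
  rw [Nat.add_sub_cancel_left]
  have hk' : (0 : ℝ) < k := by positivity
  have hl' : (0 : ℝ) < l := by positivity
  set F : ℕ → ℝ := fun n => √(2 * n) * (n / Real.exp 1) ^ n with hF
  have hFpos : ∀ n, 0 < n → 0 < F n := fun n hn => by positivity
  have hfac : ∀ n, 0 < n → (n.factorial : ℝ) = Stirling.stirlingSeq n * F n := by
    intro n hn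
    have := hFpos n hn
    rw [Stirling.stirlingSeq, div_mul_cancel₀]
    exact this.ne'
  have hanti : Stirling.stirlingSeq (k + l) ≤ Stirling.stirlingSeq k := by
    have := Stirling.stirlingSeq'_antitone (by lia : k - 1 ≤ k + l - 1)
    simpa [Nat.sub_add_cancel hk, Nat.sub_add_cancel (by lia : 1 ≤ k + l)] using this
  have hpi := Stirling.sqrt_pi_le_stirlingSeq hl.ne'
  have hs0 : 0 < Stirling.stirlingSeq k :=
    (Real.sqrt_pos.2 Real.pi_pos).trans_le (Stirling.sqrt_pi_le_stirlingSeq hk.ne')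
  have hmul : ((k + l).choose k : ℝ) * k.factorial * l.factorial = (k + l).factorial := by
    rw [Nat.choose_symm_add]
    exact_mod_cast Nat.add_choose_mul_factorial_mul_factorial k l
  have h1 : ((k + l).choose k : ℝ) * F k * (√Real.pi * F l) ≤ F (k + l) := by
    rw [hfac k hk, hfac l hl, hfac (k + l) (by lia)] at hmul
    have hC : (0 : ℝ) ≤ (k + l).choose k := by positivity
    have hk1 := hFpos k hk
    have hl1 := hFpos l hl
    have hm1 := hFpos (k + l) (by lia)
    refine le_of_mul_le_mul_left ?_ hs0
    calc Stirling.stirlingSeq k * (((k + l).choose k : ℝ) * F k * (√Real.pi * F l))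
        ≤ Stirling.stirlingSeq k * (((k + l).choose k : ℝ) * F k *
          (Stirling.stirlingSeq l * F l)) := by gcongr
      _ = Stirling.stirlingSeq (k + l) * F (k + l) := by rw [← hmul]; ring
      _ ≤ _ := by gcongr
  have hC : (0 : ℝ) ≤ (k + l).choose k := by positivity
  have h2 : (((k + l).choose k : ℝ) * F k * (√Real.pi * F l)) ^ 2 ≤ F (k + l) ^ 2 :=
    pow_le_pow_left₀ (by have := hFpos k hk; have := hFpos l hl; positivity) h1 2
  have hF2 : ∀ n : ℕ, F n ^ 2 = 2 * n * ((n : ℝ) ^ n / Real.exp 1 ^ n) ^ 2 := by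
    intro n
    simp only [hF]
    rw [mul_pow, Real.sq_sqrt (by positivity), div_pow]
  have hq : 1 - (k : ℝ) / (k + l : ℕ) = l / (k + l : ℕ) := by
    push_cast
    field_simp
    ring
  rw [mul_pow, mul_pow _ (F k), mul_pow _ (F l), Real.sq_sqrt Real.pi_pos.le, hF2, hF2, hF2] at h2
  rw [hq, div_pow, div_pow]
  push_cast at h2 ⊢
  have he : Real.exp 1 ^ (k + l) = Real.exp 1 ^ k * Real.exp 1 ^ l := pow_add _ _ _
  have hp : (k + l : ℝ) ^ (k + l) = (k + l) ^ k * (k + l) ^ l := pow_add _ _ _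
  rw [he, hp] at h2
  have hek : 0 < Real.exp 1 ^ k := by positivity
  have hel : 0 < Real.exp 1 ^ l := by positivity
  generalize Real.exp 1 ^ k = a at *
  generalize Real.exp 1 ^ l = b at *
  have h3 : (k : ℝ) + l ≠ 0 := by positivity
  have h4 : 0 < (k + l : ℝ) ^ k := by positivity
  have h5 : 0 < (k + l : ℝ) ^ l := by positivity
  generalize (k + l : ℝ) ^ k = c at *
  generalize (k + l : ℝ) ^ l = d at *
  have h6 : 0 < 2 * ((k : ℝ) + l) * (c * d / (a * b)) ^ 2 := by positivity
  have h7 := (div_le_one h6).2 h2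
  refine le_trans (le_of_eq ?_) h7
  field_simp

theorem cubic_le_exp {x : ℝ} (hx : 0 ≤ x) : 1 + x + x ^ 2 / 2 + x ^ 3 / 6 ≤ Real.exp x := by
  have := Real.sum_le_exp_of_nonneg hx 4
  simp [Finset.sum_range_succ, Nat.factorial] at this
  linarith

theorem linear_le_exp {y u H : ℝ} (hu : 0 ≤ u) (hu1 : u ≤ 1) (hy : 0.693 ≤ y)
    (hyu : 128 * u ^ 2 ≤ y) (hH : 1 / 16 ≤ H) (hHu : u ≤ 0.4 → 9 / 16 - 2 * u + 2 * u ^ 2 ≤ H) :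
    1 / 8 + 2 * u + y ≤ 0.72 * Real.exp (4 * y * H) := by
  have expmono : ∀ c : ℝ, c ≤ H → Real.exp (4 * y * c) ≤ Real.exp (4 * y * H) := fun c hc =>
    Real.exp_le_exp.2 (by gcongr)
  rcases le_or_gt u 0.2 with h2 | h2
  · have h1 := expmono 0.2425 (by nlinarith [hHu (by linarith)])
    have h3 := cubic_le_exp (by positivity : 0 ≤ 4 * y * 0.2425)
    have : 0 ≤ y ^ 3 := by positivity
    nlinarith [sq_nonneg (y - 0.45)]
  rcases le_or_gt u 0.3 with h3 | h3
  · have h1 := expmono 0.1425 (by nlinarith [hHu (by linarith)])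
    have h3 := cubic_le_exp (by positivity : 0 ≤ 4 * y * 0.1425)
    have hy5 : 5.12 ≤ y := by nlinarith
    have : 0 ≤ y ^ 3 := by positivity
    nlinarith
  rcases le_or_gt u 0.4 with h4 | h4
  · have h1 := expmono 0.0825 (by nlinarith [hHu (by linarith)])
    have h3 := cubic_le_exp (by positivity : 0 ≤ 4 * y * 0.0825)
    have hy5 : 11.52 ≤ y := by nlinarith
    have : 11.52 * y ≤ y ^ 2 := by nlinarith
    have : 11.52 * y ^ 2 ≤ y ^ 3 := by nlinarith
    nlinarith
  · have h1 := expmono (1 / 16) hH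
    have h3 := cubic_le_exp (by positivity : 0 ≤ 4 * y * (1 / 16))
    have hy5 : 20.48 ≤ y := by nlinarith
    have : 20.48 * y ≤ y ^ 2 := by nlinarith
    have : 20.48 * y ^ 2 ≤ y ^ 3 := by nlinarith
    nlinarith

theorem tilted_variance_le {m q u : ℝ} (hm : 128 ≤ m) (hu : 0 < u) (hy : 0.693 ≤ m * u ^ 2)
    (hqu : q + u < 1) (hmq : 1 ≤ m * q) :
    (1 - q) * (q + u) ^ 2 ≤ 0.72 * q *
      Real.exp (4 * (m * u ^ 2) * ((1 - 2 * q) ^ 2 - 8 / 3 * (1 - 2 * q) * u + 2 * u ^ 2)) := by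
  have hq : 0 < q := by
    by_contra h
    nlinarith
  have hmu : 128 * u ^ 2 ≤ m * u ^ 2 := by gcongr
  have hu2 : u ^ 2 ≤ q * (m * u ^ 2) := by nlinarith [sq_nonneg u]
  set y := m * u ^ 2 with hyd
  set H := (1 - 2 * q) ^ 2 - 8 / 3 * (1 - 2 * q) * u + 2 * u ^ 2 with hH
  have hHu : 2 / 9 * u ^ 2 ≤ H := by linarith [sq_nonneg (1 - 2 * q - 4 / 3 * u)]
  have hHs : (1 - 2 * q) ^ 2 / 9 ≤ H := by linarith [sq_nonneg (2 * (1 - 2 * q) - 3 * u)]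
  have hH0 : 0 ≤ H := le_trans (by positivity) hHu
  have hy0 : 0 ≤ y := by positivity
  have reduce : ∀ B : ℝ, (1 - q) * (q + u) ^ 2 ≤ q * B → B ≤ 0.72 * Real.exp (4 * y * H) →
      (1 - q) * (q + u) ^ 2 ≤ 0.72 * q * Real.exp (4 * y * H) := fun B h1 h2 => by
    linarith [mul_le_mul_of_nonneg_left h2 hq.le]
  rcases le_or_gt (1 / 4) q with h4 | h4
  · refine reduce (0.25 + 1.5 * u + 3 * u ^ 2) ?_ ?_
    · linarith [mul_nonneg hq.le (sq_nonneg (1 - 2 * q)), mul_nonneg (mul_nonneg hq.le hu.le)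
        (by linarith : 0 ≤ q - 1 / 4), mul_nonneg (sq_nonneg u) (by linarith : 0 ≤ q - 1 / 4)]
    · have h1 := Real.add_one_le_exp (4 * y * H)
      have h2 : 4 * (128 * u ^ 2) * (2 / 9 * u ^ 2) ≤ 4 * y * H := by gcongr
      nlinarith [sq_nonneg (u ^ 2 - 0.05), sq_nonneg (u - 0.2)]
  rcases le_or_gt (1 / 8) q with h8 | h8
  · refine reduce (0.1875 + 1.75 * u + 7 * u ^ 2) ?_ ?_
    · have h1 : (1 - q) * q ≤ 0.1875 := by nlinarith
      linarith [mul_le_mul_of_nonneg_left h1 hq.le, mul_nonneg (mul_nonneg hq.le hu.le)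
        (by linarith : 0 ≤ q - 1 / 8), mul_nonneg (sq_nonneg u) (by linarith : 0 ≤ q - 1 / 8)]
    · have h1 := Real.add_one_le_exp (4 * y * H)
      have h3 : 1 / 36 ≤ H := by nlinarith
      have h2 : 4 * (128 * u ^ 2) * (1 / 36) ≤ 4 * y * H := by gcongr
      nlinarith [sq_nonneg (u - 0.25)]
  refine reduce (1 / 8 + 2 * u + y) ?_ ?_
  · have h1 : (1 - q) * q * q ≤ 1 / 8 * q := by gcongr; linarith [sq_nonneg q]
    have h2 : (1 - q) * (2 * q * u) ≤ 2 * q * u := by linarith [mul_pos (mul_pos hq hq) hu]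
    have h3 : (1 - q) * u ^ 2 ≤ q * y := by linarith [mul_nonneg hq.le (sq_nonneg u)]
    linarith
  refine linear_le_exp hu.le (by linarith) hy hmu (by nlinarith) fun hu4 => ?_
  have h1 : 0 ≤ (1 - 2 * q - 3 / 4) * (1 - 2 * q + 3 / 4 - 8 / 3 * u) :=
    mul_nonneg (by linarith) (by linarith)
  linarith

theorem two_pi_mul_le_exp {m u : ℝ} (hm : 128 ≤ m) (hu : 0 < u) (hy : 0.693 ≤ m * u ^ 2) :
    2 * Real.pi * (m * u ^ 2) ≤
      0.72 * Real.exp (4 * (m * u ^ 2) * (1 - 8 / 3 * u + 2 * u ^ 2)) := by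
  have hmu : 128 * u ^ 2 ≤ m * u ^ 2 := by gcongr
  set y := m * u ^ 2 with hyd
  set H := 1 - 8 / 3 * u + 2 * u ^ 2 with hH
  have hy0 : 0 ≤ y := by positivity
  have hpi : 2 * Real.pi * y ≤ 6.3 * y := by nlinarith [Real.pi_lt_d2]
  refine hpi.trans ?_
  have expmono : ∀ c : ℝ, c ≤ H → Real.exp (4 * y * c) ≤ Real.exp (4 * y * H) := fun c hc =>
    Real.exp_le_exp.2 (by gcongr)
  have he2 : 7.38 ≤ Real.exp 2 := by
    have h1 := Real.exp_one_gt_d9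
    have : Real.exp 2 = Real.exp 1 * Real.exp 1 := by rw [← Real.exp_add]; norm_num
    nlinarith
  have he4 : 54 ≤ Real.exp 4 := by
    have : Real.exp 4 = Real.exp 2 * Real.exp 2 := by rw [← Real.exp_add]; norm_num
    nlinarith
  have hexp2 : ∀ x : ℝ, 1 ≤ x → 7.38 * (x - 1) ≤ Real.exp x := by
    intro x hx
    have h1 := Real.add_one_le_exp (x - 2)
    have : Real.exp x = Real.exp 2 * Real.exp (x - 2) := by rw [← Real.exp_add]; ring_nf
    rw [this]
    exact mul_le_mul he2 (by linarith) (by linarith) (Real.exp_nonneg _)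
  have hexp4 : ∀ x : ℝ, 3 ≤ x → 54 * (x - 3) ≤ Real.exp x := by
    intro x hx
    have h1 := Real.add_one_le_exp (x - 4)
    have : Real.exp x = Real.exp 4 * Real.exp (x - 4) := by rw [← Real.exp_add]; ring_nf
    rw [this]
    exact mul_le_mul he4 (by linarith) (by linarith) (Real.exp_nonneg _)
  rcases le_or_gt u 0.1 with h1 | h1
  · have h1 := expmono 0.753 (by nlinarith)
    linarith [hexp2 (4 * y * 0.753) (by linarith)]
  rcases le_or_gt u 0.2 with h2 | h2
  · have h1 := expmono 0.546 (by nlinarith)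
    have hy1 : 1.28 ≤ y := by nlinarith
    linarith [hexp2 (4 * y * 0.546) (by linarith)]
  rcases le_or_gt u 0.4 with h4 | h4
  · have h1 := expmono 0.253 (by nlinarith)
    have hy1 : 5.12 ≤ y := by nlinarith
    linarith [hexp4 (4 * y * 0.253) (by linarith)]
  · have h1 := expmono (1 / 9) (by nlinarith [sq_nonneg (u - 2 / 3)])
    have hy1 : 20.48 ≤ y := by nlinarith
    linarith [hexp4 (4 * y * (1 / 9)) (by linarith)]

theorem exp_mul_logLik_sq_le {m k : ℕ} {u : ℝ} (hkm : k < m) (hu : 0 ≤ u)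
    (hqu : k / m + u < 1) :
    Real.exp (m * logLik (k / m) 0 (k / m + u)) ^ 2 ≤
      ((k / m : ℝ) ^ k * (1 - k / m) ^ (m - k)) ^ 2 *
        Real.exp (-(4 * (m * u ^ 2) * ((1 - 2 * (k / m)) ^ 2 - 8 / 3 * (1 - 2 * (k / m)) * u +
          2 * u ^ 2))) := by
  have hm : 0 < m := by lia
  have hm' : (0 : ℝ) < m := by positivity
  have hq0 : (0 : ℝ) ≤ k / m := by positivity
  have hpeak : Real.exp (m * logLik (k / m) 1 (k / m)) =
      (k / m : ℝ) ^ k * (1 - k / m) ^ (m - k) := by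
    rcases Nat.eq_zero_or_pos k with rfl | hk
    · simp [logLik]
    · have h := exp_mul_logLik hm hkm.le (x := k / m) (by positivity) (by linarith)
      rw [sub_self, zero_pow two_ne_zero, mul_zero, Real.exp_zero, mul_one] at h
      rw [← h]
      simp [logLik]
  have hanti := logLik_anti (c := 1) le_rfl hq0 le_rfl (le_add_of_nonneg_right hu) hqu
  rw [← hpeak, ← Real.exp_nat_mul, ← Real.exp_nat_mul, ← Real.exp_add]
  refine Real.exp_le_exp.2 ?_
  have h := mul_le_mul_of_nonneg_left hanti hm'.le
  have hsplit : logLik (k / m) 0 (k / m + u) = logLik (k / m) 1 (k / m + u) -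
      (2 * (1 - 2 * (k / m)) ^ 2 * u ^ 2 - 16 / 3 * (1 - 2 * (k / m)) * u ^ 3 + 4 * u ^ 4) := by
    simp only [logLik]
    ring
  rw [hsplit]
  push_cast
  linarith

theorem prefactor_sq_le {m k : ℕ} {u : ℝ} (hm : 128 ≤ m) (hkm : k < m) (hu : 0 < u)
    (hy : 0.693 ≤ m * u ^ 2) (hqu : k / m + u < 1) :
    (m.choose k * Real.exp (m * logLik (k / m) 0 (k / m + u)) *
      ((1 - k / m) * (k / m + u) / u)) ^ 2 * (2 * Real.pi * (m * u ^ 2)) ≤ 0.72 := by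
  have hm128 : (128 : ℝ) ≤ m := by exact_mod_cast hm
  have hm' : (0 : ℝ) < m := by linarith
  have hpi := Real.pi_pos
  have hG := exp_mul_logLik_sq_le hkm hu.le hqu
  rcases Nat.eq_zero_or_pos k with rfl | hk
  · have h := two_pi_mul_le_exp hm128 hu hy
    simp only [Nat.cast_zero, zero_div, zero_add, mul_zero, sub_zero, one_pow, mul_one, one_mul,
      Nat.choose_zero_right, Nat.cast_one, pow_zero, Nat.sub_zero] at hG ⊢
    rw [div_self hu.ne', mul_one]
    refine (mul_le_mul_of_nonneg_right hG (by positivity)).trans ?_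
    rw [Real.exp_neg, inv_mul_le_iff₀ (Real.exp_pos _), mul_comm]
    linarith
  · have hmq : 1 ≤ m * ((k : ℝ) / m) := by
      rw [mul_div_cancel₀ _ hm'.ne']
      exact_mod_cast hk
    have h := tilted_variance_le hm128 hu hy hqu hmq
    have hst := choose_mul_sq_le hk hkm
    have hq : (0 : ℝ) < k / m := by positivity
    generalize (k : ℝ) / m = q at *
    have hq1 : 0 < 1 - q := by linarith
    set E := 4 * (m * u ^ 2) * ((1 - 2 * q) ^ 2 - 8 / 3 * (1 - 2 * q) * u + 2 * u ^ 2)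
    set P := q ^ k * (1 - q) ^ (m - k)
    set C : ℝ := (m.choose k : ℝ)
    calc _ = C ^ 2 * Real.exp (m * logLik q 0 (q + u)) ^ 2 *
          (((1 - q) * (q + u) / u) ^ 2 * (2 * Real.pi * (m * u ^ 2))) := by ring
      _ ≤ C ^ 2 * (P ^ 2 * Real.exp (-E)) *
          (((1 - q) * (q + u) / u) ^ 2 * (2 * Real.pi * (m * u ^ 2))) := by gcongr
      _ = ((C * P) ^ 2 * (2 * Real.pi * m * q * (1 - q))) *
          (((1 - q) * (q + u) ^ 2) / q * Real.exp (-E)) := by field_simp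
      _ ≤ 1 * ((0.72 * q * Real.exp E) / q * Real.exp (-E)) := by gcongr
      _ = 0.72 := by
          rw [Real.exp_neg]
          field_simp

theorem exists_hasTailFactors_of_ge {m : ℕ} (hm : 128 ≤ m) : ∃ r, HasTailFactors m r := by
  refine ⟨fun n => 0.576 * 0.708 ^ n, fun n => by positivity, ?_, ?_, ?_⟩
  · exact (summable_geometric_of_lt_one (by norm_num) (by norm_num)).mul_left _
  · rw [tsum_mul_left, tsum_geometric_of_lt_one (by norm_num) (by norm_num)]
    norm_num
  · intro n k ε p hk hε0 hε hp hp1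
    have hlog := Real.log_two_gt_d9
    have hm' : (0 : ℝ) < m := by
      have : 0 < m := by lia
      positivity
    have h2n : (1 : ℝ) ≤ 2 ^ n := one_le_pow₀ (by norm_num)
    have hy : 2 ^ n * 0.3465 ≤ m * ε ^ 2 := by nlinarith
    have hy' : 0.693 ≤ m * ε ^ 2 := by nlinarith
    have hε0' : 0 < ε := by
      refine hε0.lt_of_ne fun h => ?_
      rw [← h] at hy'
      norm_num at hy'
    refine (binomTail_le_exp_mul hk hε0' le_rfl hp hp1).trans ?_
    refine mul_le_mul_of_nonneg_left ?_ (Real.exp_nonneg _)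
    have h := prefactor_sq_le hm hk hε0' hy' (by linarith)
    refine abs_le_of_sq_le_sq' ?_ (by positivity) |>.2
    refine le_of_mul_le_mul_right (h.trans ?_) (by positivity : 0 < 2 * Real.pi * (m * ε ^ 2))
    have hpi := Real.pi_gt_d2
    have h5 : ((0.708 : ℝ) ^ n) ^ 2 * 2 ^ n ≥ 1 := by
      rw [← pow_mul, mul_comm n 2, pow_mul, ← mul_pow]
      exact one_le_pow₀ (by norm_num)
    calc (0.72 : ℝ) ≤ 0.576 ^ 2 * (2 * 3.14 * 0.3465) * 1 := by norm_num
      _ ≤ 0.576 ^ 2 * (2 * 3.14 * 0.3465) * ((0.708 ^ n) ^ 2 * 2 ^ n) := by gcongr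
      _ = (0.576 * 0.708 ^ n) ^ 2 * (2 * 3.14 * (2 ^ n * 0.3465)) := by ring
      _ ≤ _ := by gcongr

theorem measure_pi_card_le {Y : Type*} [MeasurableSpace Y] (D : Measure Y) [IsProbabilityMeasure D]
    {E : Set Y} (hE : MeasurableSet E) (m k : ℕ) [DecidablePred (· ∈ E)] :
    (Measure.pi fun _ : Fin m => D)
      {S | (Finset.univ.filter fun i => S i ∈ E).card ≤ k} ≤
        ENNReal.ofReal (binomTail m k (D E).toReal) := by
  have hp1 : (D E).toReal ≤ 1 := measureReal_le_one
  have hcompl : (D Eᶜ) = ENNReal.ofReal (1 - (D E).toReal) := by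
    rw [prob_compl_eq_one_sub hE, ENNReal.ofReal_sub _ ENNReal.toReal_nonneg,
      ENNReal.ofReal_toReal (measure_ne_top _ _), ENNReal.ofReal_one]
  have hsub : {S : Fin m → Y | (Finset.univ.filter fun i => S i ∈ E).card ≤ k} ⊆
      ⋃ j ∈ Finset.range (k + 1), ⋃ T ∈ Finset.powersetCard j (Finset.univ : Finset (Fin m)),
        Set.univ.pi fun i => if i ∈ T then E else Eᶜ := by
    intro S hS
    simp only [Set.mem_iUnion]
    refine ⟨_, Finset.mem_range.2 (Nat.lt_succ_of_le hS), Finset.univ.filter fun i => S i ∈ E,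
      Finset.mem_powersetCard.2 ⟨Finset.subset_univ _, rfl⟩, fun i _ => ?_⟩
    by_cases h : S i ∈ E <;> simp [h]
  have hcell : ∀ j, ∀ T ∈ Finset.powersetCard j (Finset.univ : Finset (Fin m)),
      (Measure.pi fun _ : Fin m => D) (Set.univ.pi fun i => if i ∈ T then E else Eᶜ) =
        ENNReal.ofReal ((D E).toReal ^ j * (1 - (D E).toReal) ^ (m - j)) := by
    intro j T hT
    have hT := (Finset.mem_powersetCard.1 hT).2
    rw [Measure.pi_pi]
    have : ∀ i, D (if i ∈ T then E else Eᶜ) = if i ∈ T then D E else D Eᶜ := fun i => by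
      split_ifs <;> rfl
    simp only [this]
    rw [Finset.prod_ite, Finset.prod_const, Finset.prod_const, Finset.filter_not, hcompl,
      ← Finset.compl_eq_univ_sdiff, Finset.card_compl, Finset.filter_mem_eq_inter,
      Finset.univ_inter, hT, Fintype.card_fin, ENNReal.ofReal_mul (by positivity),
      ENNReal.ofReal_pow ENNReal.toReal_nonneg, ENNReal.ofReal_pow (by linarith),
      ENNReal.ofReal_toReal (measure_ne_top _ _)]
  refine (measure_mono hsub).trans ((measure_biUnion_finset_le _ _).trans ?_)
  have h0 : 0 ≤ 1 - (D E).toReal := by linarith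
  rw [binomTail, ENNReal.ofReal_sum_of_nonneg fun j _ => by positivity]
  refine Finset.sum_le_sum fun j _ => (measure_biUnion_finset_le _ _).trans ?_
  rw [Finset.sum_congr rfl (hcell j), Finset.sum_const, Finset.card_powersetCard,
    Finset.card_univ, Fintype.card_fin, ENNReal.ofReal_mul (Nat.cast_nonneg _),
    ENNReal.ofReal_natCast, nsmul_eq_mul]

theorem measure_empError_add_lt_le {X : Type*} [MeasurableSpace X] (D : Measure (X × Bool))
    [IsProbabilityMeasure D] {h : X → Bool} (hh : Measurable h) {m : ℕ} (hm : 0 < m)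
    {r : ℕ → ℝ} (hr : HasTailFactors m r) {n : ℕ} {ε : ℝ} (hε0 : 0 ≤ ε)
    (hε : (2 ^ n + 1) * Real.log 2 ≤ 2 * m * ε ^ 2) :
    (Measure.pi fun _ : Fin m => D) {S | empError S h + ε < trueError D h} ≤
      ENNReal.ofReal (Real.exp (-(2 * m * ε ^ 2)) * r n) := by
  classical
  have hm' : (0 : ℝ) < m := by positivity
  have hE : MeasurableSet {p : X × Bool | h p.1 ≠ p.2} :=
    (measurableSet_eq_fun (hh.comp measurable_fst) measurable_snd).compl
  set p := trueError D h with hp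
  have hp1 : p ≤ 1 := measureReal_le_one
  have hfail : {S : Fin m → X × Bool | empError S h + ε < p} =
      {S | ((Finset.univ.filter fun i => S i ∈ {p : X × Bool | h p.1 ≠ p.2}).card : ℝ) <
        m * (p - ε)} := by
    ext S
    simp only [Set.mem_ofPred_eq, empError]
    rw [← lt_sub_iff_add_lt, div_lt_iff₀ hm', Finset.sum_boole, mul_comm]
  rw [hfail]
  set x := m * (p - ε) with hx
  rcases Nat.eq_zero_or_pos ⌈x⌉₊ with h0 | h0
  · have hx0 : x ≤ 0 := Nat.ceil_eq_zero.1 h0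
    refine le_of_eq_of_le ?_ zero_le
    refine (congrArg _ (Set.eq_empty_of_forall_notMem fun S hS => ?_)).trans measure_empty
    exact (hx0.trans (Nat.cast_nonneg _)).not_gt hS
  · obtain ⟨k, hk⟩ : ∃ k, ⌈x⌉₊ = k + 1 := ⟨⌈x⌉₊ - 1, by lia⟩
    have hkx : (k : ℝ) < x := Nat.lt_ceil.1 (by lia)
    have hkm : k < m := by
      have : x ≤ m := by rw [hx]; nlinarith
      exact_mod_cast hkx.trans_le this
    have hkp : k / m + ε < p := by
      rw [← lt_sub_iff_add_lt, div_lt_iff₀ hm', mul_comm]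
      exact hkx
    refine le_trans (measure_mono fun S hS => ?_) ((measure_pi_card_le D hE m k).trans
      (ENNReal.ofReal_le_ofReal (hr.2.2.2 n k ε p hkm hε0 hε hkp hp1)))
    have := Nat.lt_ceil.2 (Set.mem_ofPred_eq.mp hS)
    rw [hk] at this
    exact Nat.lt_succ_iff.1 this

theorem exists_hasTailFactors {m : ℕ} (hm : 1 ≤ m) : ∃ r, HasTailFactors m r := by
  rcases lt_or_ge m 128 with h | h
  · exact exists_hasTailFactors_of_lt hm h
  · exact exists_hasTailFactors_of_ge h

theorem penalty_nonneg (w : ℕ → ℝ) (δ : ℝ) (m n : ℕ) : 0 ≤ penalty w δ m n := Real.sqrt_nonneg _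

theorem two_mul_penalty_sq {w : ℕ → ℝ} {δ : ℝ} {m n : ℕ} (hw : w n ∈ Set.Ioc (0 : ℝ) 1)
    (hδ : δ ∈ Set.Ioo (0 : ℝ) 1) (hm : 0 < m) :
    2 * m * penalty w δ m n ^ 2 =
      -Real.log (w n) - Real.log δ + (2 ^ n + 1) * Real.log 2 := by
  have hlw := Real.log_nonpos hw.1.le hw.2
  have hlδ := Real.log_nonpos hδ.1.le hδ.2.le
  have h2 : 0 < Real.log 2 := Real.log_pos one_lt_two
  have hlog : Real.log ((2 : ℝ) ^ (2 ^ n + 1) / δ) = (2 ^ n + 1) * Real.log 2 - Real.log δ := by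
    rw [Real.log_div (by positivity) hδ.1.ne', Real.log_pow]
    push_cast
    ring
  have h0 : 0 ≤ (2 ^ n + 1) * Real.log 2 := by positivity
  rw [penalty, hlog, Real.sq_sqrt (div_nonneg (by linarith) (by positivity))]
  field_simp
  ring

theorem card_mul_exp_penalty_le {w : ℕ → ℝ} {δ : ℝ} {m n : ℕ} (hw : w n ∈ Set.Ioc (0 : ℝ) 1)
    (hδ : δ ∈ Set.Ioo (0 : ℝ) 1) (hm : 0 < m) :
    2 ^ 2 ^ n * Real.exp (-(2 * m * penalty w δ m n ^ 2)) ≤ δ / 2 := by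
  have : -(2 * m * penalty w δ m n ^ 2) =
      Real.log (w n) + Real.log δ + -((2 ^ n + 1 : ℕ) * Real.log 2) := by
    rw [two_mul_penalty_sq hw hδ hm]
    push_cast
    ring
  rw [this, Real.exp_add, Real.exp_add, Real.exp_log hw.1, Real.exp_log hδ.1, Real.exp_neg,
    Real.exp_nat_mul, Real.exp_log two_pos, pow_succ]
  have hw1 := hw.2
  have hδ0 := hδ.1
  calc 2 ^ 2 ^ n * (w n * δ * (2 ^ 2 ^ n * 2)⁻¹) = w n * (δ / 2) := by field_simp
    _ ≤ 1 * (δ / 2) := by gcongr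
    _ = δ / 2 := one_mul _

theorem measure_exists_penalized_lt_le {X : Type*} [MeasurableSpace X] {w : ℕ → ℝ}
    (hw : ∀ n, w n ∈ Set.Ioc (0 : ℝ) 1) {Hn : ℕ → Finset (X → Bool)}
    (hcard : ∀ n, (Hn n).card ≤ 2 ^ 2 ^ n) (hmeas : ∀ n, ∀ h ∈ Hn n, Measurable h)
    {δ : ℝ} (hδ : δ ∈ Set.Ioo (0 : ℝ) 1) (D : Measure (X × Bool)) [IsProbabilityMeasure D]
    {m : ℕ} (hm : 1 ≤ m) :
    (Measure.pi fun _ : Fin m => D)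
      (⋃ n, ⋃ h ∈ Hn n, {S | empError S h + penalty w δ m n < trueError D h}) ≤
        ENNReal.ofReal δ := by
  obtain ⟨r, hr⟩ := exists_hasTailFactors hm
  have hlevel : ∀ n, (Measure.pi fun _ : Fin m => D)
      (⋃ h ∈ Hn n, {S | empError S h + penalty w δ m n < trueError D h}) ≤
        ENNReal.ofReal (δ / 2 * r n) := by
    intro n
    have hε : (2 ^ n + 1) * Real.log 2 ≤ 2 * m * penalty w δ m n ^ 2 := by
      rw [two_mul_penalty_sq (hw n) hδ hm]
      linarith [Real.log_nonpos (hw n).1.le (hw n).2, Real.log_nonpos hδ.1.le hδ.2.le]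
    have hr0 := hr.1 n
    calc _ ≤ ∑ h ∈ Hn n, (Measure.pi fun _ : Fin m => D)
          {S | empError S h + penalty w δ m n < trueError D h} := measure_biUnion_finset_le _ _
      _ ≤ (Hn n).card • ENNReal.ofReal (Real.exp (-(2 * m * penalty w δ m n ^ 2)) * r n) :=
          Finset.sum_le_card_nsmul _ _ _ fun h hh =>
            measure_empError_add_lt_le D (hmeas n h hh) hm hr (penalty_nonneg w δ m n) hε
      _ = ENNReal.ofReal ((Hn n).card * Real.exp (-(2 * m * penalty w δ m n ^ 2)) * r n) := by
          rw [nsmul_eq_mul, mul_assoc ((Hn n).card : ℝ), ENNReal.ofReal_mul (Nat.cast_nonneg _),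
            ENNReal.ofReal_natCast]
      _ ≤ _ := by
          apply ENNReal.ofReal_le_ofReal
          gcongr
          refine le_trans ?_ (card_mul_exp_penalty_le (hw n) hδ hm)
          gcongr
          exact_mod_cast hcard n
  have hδ2 : 0 ≤ δ / 2 := by linarith [hδ.1]
  refine (measure_iUnion_le _).trans ((ENNReal.tsum_le_tsum hlevel).trans ?_)
  rw [← ENNReal.ofReal_tsum_of_nonneg (fun n => mul_nonneg hδ2 (hr.1 n)) (hr.2.1.mul_left _),
    tsum_mul_left]
  apply ENNReal.ofReal_le_ofReal
  nlinarith [hr.2.2.1]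

/-- Risk guarantee for the GML (structural risk minimization) rule: if for each
sample `S` the hypothesis `ĥ(S) ∈ H` minimizes the penalized empirical risk
`F_S(h) = L_S(h) + penalty(n(h))` over `H = ⋃ n, H n`, then with probability at
least `1 - δ` over `S ~ D^m`, for every `h ∈ H`,
`L_D(ĥ(S)) ≤ L_S(h) + penalty(n(h))`. -/
theorem gml_risk_guarantee
    {X : Type*} [MeasurableSpace X]
    (w : ℕ → ℝ) (hw : ∀ n, w n ∈ Set.Ioc (0 : ℝ) 1) (hsum : ∑' n : ℕ, w n ≤ 1)
    (Hn : ℕ → Finset (X → Bool)) (hcard : ∀ n, (Hn n).card ≤ 2 ^ 2 ^ n)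
    (hmeas : ∀ n, ∀ h ∈ Hn n, Measurable h)
    (nh : (X → Bool) → ℕ)
    (hnh : ∀ h ∈ ⋃ n : ℕ, (Hn n : Set (X → Bool)), h ∈ Hn (nh h))
    (δ : ℝ) (hδ : δ ∈ Set.Ioo (0 : ℝ) 1)
    (D : Measure (X × Bool)) [IsProbabilityMeasure D]
    (m : ℕ) (hm : 1 ≤ m)
    (hhat : (Fin m → X × Bool) → (X → Bool))
    (hhat_mem : ∀ S : Fin m → X × Bool, hhat S ∈ ⋃ n : ℕ, (Hn n : Set (X → Bool)))
    (hhat_min : ∀ S : Fin m → X × Bool, ∀ h ∈ ⋃ n : ℕ, (Hn n : Set (X → Bool)),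
      empError S (hhat S) + penalty w δ m (nh (hhat S)) ≤
        empError S h + penalty w δ m (nh h)) :
    (Measure.pi fun _ : Fin m => D)
      {S : Fin m → X × Bool | ∀ h ∈ ⋃ n : ℕ, (Hn n : Set (X → Bool)),
        trueError D (hhat S) ≤ empError S h + penalty w δ m (nh h)}
      ≥ ENNReal.ofReal (1 - δ) := by
  set bad : Set (Fin m → X × Bool) :=
    ⋃ n, ⋃ h ∈ Hn n, {S | empError S h + penalty w δ m n < trueError D h} with hbad
  set good : Set (Fin m → X × Bool) := {S | ∀ h ∈ ⋃ n : ℕ, (Hn n : Set (X → Bool)),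
    trueError D (hhat S) ≤ empError S h + penalty w δ m (nh h)} with hgood
  have hcover : Set.univ ⊆ good ∪ bad := by
    intro S _
    by_cases hS : S ∈ bad
    · exact Or.inr hS
    · refine Or.inl fun h hh => le_trans ?_ (hhat_min S h hh)
      by_contra! hlt
      refine hS ?_
      simp only [hbad, Set.mem_iUnion]
      exact ⟨nh (hhat S), hhat S, hnh _ (hhat_mem S), hlt⟩
  have hprob := (measure_mono hcover).trans
    (measure_union_le (μ := Measure.pi fun _ : Fin m => D) good bad)
  rw [measure_univ] at hprob
  rw [ge_iff_le, ENNReal.ofReal_sub _ hδ.1.le, ENNReal.ofReal_one, tsub_le_iff_right]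
  exact hprob.trans
    (add_le_add le_rfl (measure_exists_penalized_lt_le hw hcard hmeas hδ D hm))
end

section
/- VC dimension of a finite union of classes: let H₁, …, H_r (r ≥ 1) be hypothesis classes of functions X → Bool over a fixed domain X, let d ≥ 1, and suppose no H_i shatters any finite subset of X of cardinality greater than d (i.e., VCdim(H_i) ≤ d for each i). Then the union ⋃_{i=1}^r H_i shatters no finite subset of X of cardinality greater than 4d·log₂(2d) + 2·log₂(r). -/
/-- A class `H` of hypotheses `X → Bool` shatters a finite set `C ⊆ X` if every
Boolean labeling of `C` is realized by some `h ∈ H`. -/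
def Shatters {X : Type*} (H : Set (X → Bool)) (C : Finset X) : Prop :=
  ∀ g : X → Bool, ∃ h ∈ H, ∀ x ∈ C, h x = g x

open scoped Classical in
/-- The traces on `C` of the hypotheses in `H`, as a family of subsets of `C`. -/
noncomputable def traceFamily {X : Type*} (H : Set (X → Bool)) (C : Finset X) :
    Finset (Finset X) :=
  {s ∈ C.powerset | ∃ h ∈ H, ∀ x ∈ C, h x = true ↔ x ∈ s}

lemma mem_traceFamily {X : Type*} {H : Set (X → Bool)} {C s : Finset X} :
    s ∈ traceFamily H C ↔ s ⊆ C ∧ ∃ h ∈ H, ∀ x ∈ C, h x = true ↔ x ∈ s := by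
  simp [traceFamily]

lemma sum_choose_le_add_one_pow (n d : ℕ) :
    ∑ k ∈ Finset.range (d + 1), n.choose k ≤ (n + 1) ^ d := by
  rw [add_pow]
  refine Finset.sum_le_sum fun k hk => ?_
  have hkd : 0 < d.choose k := Nat.choose_pos (by simpa [Nat.lt_succ_iff] using hk)
  calc n.choose k ≤ n ^ k := Nat.choose_le_pow n k
    _ ≤ n ^ k * 1 ^ (d - k) * d.choose k := by
      rw [one_pow, mul_one]; exact Nat.le_mul_of_pos_right _ hkd

open scoped Classical in
lemma subset_of_shatters_traceFamily {X : Type*} {H : Set (X → Bool)} {C s : Finset X}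
    (hs : (traceFamily H C).Shatters s) : s ⊆ C := by
  obtain ⟨t, ht, hst⟩ := hs.exists_superset
  exact hst.trans (mem_traceFamily.1 ht).1

open scoped Classical in
lemma shatters_of_shatters_traceFamily {X : Type*} {H : Set (X → Bool)} {C s : Finset X}
    (hs : (traceFamily H C).Shatters s) : Shatters H s := by
  intro g
  obtain ⟨t, ht, hst⟩ := hs (Finset.filter_subset (fun x => g x = true) s)
  obtain ⟨-, h, hH, hh⟩ := mem_traceFamily.1 ht
  refine ⟨h, hH, fun x hx => ?_⟩
  have h₁ := hh x (subset_of_shatters_traceFamily hs hx)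
  have h₂ : x ∈ t ↔ g x = true := by
    have := Finset.ext_iff.1 hst x
    simpa [hx] using this
  exact Bool.eq_iff_iff.2 (h₁.trans h₂)

/-- A polynomial form of the Sauer–Shelah lemma. -/
lemma card_traceFamily_le {X : Type*} {H : Set (X → Bool)} {d : ℕ}
    (hH : ∀ C : Finset X, d < C.card → ¬ Shatters H C) (C : Finset X) :
    (traceFamily H C).card ≤ (C.card + 1) ^ d := by
  classical
  have hsub : (traceFamily H C).shatterer ⊆
      (Finset.range (d + 1)).biUnion fun k => C.powersetCard k := by
    intro s hs
    rw [Finset.mem_shatterer] at hs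
    have hd : s.card ≤ d := not_lt.1 fun h => hH s h (shatters_of_shatters_traceFamily hs)
    simpa [Nat.lt_succ_iff, Finset.mem_powersetCard, hd] using subset_of_shatters_traceFamily hs
  calc (traceFamily H C).card ≤ (traceFamily H C).shatterer.card :=
        Finset.card_le_card_shatterer _
    _ ≤ _ := Finset.card_le_card hsub
    _ ≤ ∑ k ∈ Finset.range (d + 1), (C.powersetCard k).card := Finset.card_biUnion_le
    _ = ∑ k ∈ Finset.range (d + 1), C.card.choose k := by simp
    _ ≤ _ := sum_choose_le_add_one_pow _ _

lemma two_pow_card_le_of_shatters_iUnion {X : Type*} {r d : ℕ} {H : Fin r → Set (X → Bool)}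
    (hH : ∀ i : Fin r, ∀ C : Finset X, d < C.card → ¬ Shatters (H i) C) {C : Finset X}
    (hC : Shatters (⋃ i : Fin r, H i) C) : 2 ^ C.card ≤ r * (C.card + 1) ^ d := by
  classical
  have hsub : C.powerset ⊆ Finset.univ.biUnion fun i => traceFamily (H i) C := by
    intro s hs
    obtain ⟨h, hh, hs'⟩ := hC fun x => decide (x ∈ s)
    obtain ⟨i, hi⟩ := Set.mem_iUnion.1 hh
    refine Finset.mem_biUnion.2 ⟨i, Finset.mem_univ i, mem_traceFamily.2
      ⟨Finset.mem_powerset.1 hs, h, hi, fun x hx => ?_⟩⟩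
    simp [hs' x hx]
  calc 2 ^ C.card = C.powerset.card := (Finset.card_powerset C).symm
    _ ≤ _ := Finset.card_le_card hsub
    _ ≤ ∑ i : Fin r, (traceFamily (H i) C).card := Finset.card_biUnion_le
    _ ≤ ∑ _i : Fin r, (C.card + 1) ^ d :=
      Finset.sum_le_sum fun i _ => card_traceFamily_le (hH i) C
    _ = r * (C.card + 1) ^ d := by simp

lemma logb_two_add_one_le {d n : ℝ} (hd : 1 ≤ d) (hn : 0 ≤ n) :
    Real.logb 2 (n + 1) ≤ 2 * Real.logb 2 (2 * d) + n / (2 * d) := by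
  have hd₀ : 0 < d := by linarith
  have hq : 0 ≤ n / (4 * d) := by positivity
  have hle : n + 1 ≤ (2 * d) ^ 2 * (1 + n / (4 * d)) := by
    have : (2 * d) ^ 2 * (1 + n / (4 * d)) = 4 * d ^ 2 + d * n := by field_simp; norm_num
    nlinarith
  have hlog : Real.logb 2 (1 + n / (4 * d)) ≤ n / (2 * d) := by
    have h₁ : Real.log (1 + n / (4 * d)) ≤ n / (4 * d) := by
      have := Real.log_le_sub_one_of_pos (x := 1 + n / (4 * d)) (by linarith)
      linarith
    rw [Real.logb, div_le_iff₀ (Real.log_pos one_lt_two)]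
    have h₂ : n / (2 * d) = 2 * (n / (4 * d)) := by field_simp; norm_num
    nlinarith [Real.log_two_gt_d9]
  calc Real.logb 2 (n + 1) ≤ Real.logb 2 ((2 * d) ^ 2 * (1 + n / (4 * d))) :=
        Real.logb_le_logb_of_le one_lt_two (by linarith) hle
    _ = 2 * Real.logb 2 (2 * d) + Real.logb 2 (1 + n / (4 * d)) := by
      rw [Real.logb_mul (by positivity) (by positivity), Real.logb_pow]; norm_num
    _ ≤ _ := by linarith

/-- VC dimension of a finite union of classes: if none of the classes
`H 1, …, H r` shatters a finite set of cardinality greater than `d` (`d ≥ 1`,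
`r ≥ 1`), then their union shatters no finite set of cardinality greater than
`4·d·log₂(2d) + 2·log₂ r`. -/
theorem vcDim_finite_union
    {X : Type*} (r : ℕ) (hr : 1 ≤ r) (H : Fin r → Set (X → Bool))
    (d : ℕ) (hd : 1 ≤ d)
    (hH : ∀ i : Fin r, ∀ C : Finset X, d < C.card → ¬ Shatters (H i) C) :
    ∀ C : Finset X,
      4 * (d : ℝ) * Real.logb 2 (2 * d) + 2 * Real.logb 2 r < C.card →
      ¬ Shatters (⋃ i : Fin r, H i) C := by
  intro C hcard hC
  have hpow : (2 : ℝ) ^ C.card ≤ r * ((C.card : ℝ) + 1) ^ d := by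
    exact_mod_cast two_pow_card_le_of_shatters_iUnion hH hC
  have hr₀ : (r : ℝ) ≠ 0 := by positivity
  have hd₁ : (1 : ℝ) ≤ d := by exact_mod_cast hd
  have hlog := Real.logb_le_logb_of_le one_lt_two (by positivity) hpow
  rw [Real.logb_mul hr₀ (by positivity), Real.logb_pow, Real.logb_pow,
    Real.logb_self_eq_one one_lt_two, mul_one] at hlog
  have hmul := mul_le_mul_of_nonneg_left
    (logb_two_add_one_le hd₁ (Nat.cast_nonneg C.card)) (by linarith : (0 : ℝ) ≤ d)
  have hhalf : (d : ℝ) * (C.card / (2 * d)) = C.card / 2 := by field_simp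
  rw [mul_add, hhalf] at hmul
  linarith
end
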